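/- arXiv:1605.00174 — 3 statements merged into one kernel-verified Lean document; each statement's English description precedes it below -/
import Mathlib

section
/- The kernel map T ↦ ker(T) is a bijection from the set of reduction operators relative to a well-ordered set (G,<) onto the set of linear subspaces of K⟨G⟩. -/
/-- `T` is a reduction operator relative to `(G,<)`. -/
def IsRedOp {K G : Type*} [Field K] [LinearOrder G]
    (T : Module.End K (G →₀ K)) : Prop :=
  T ∘ₗ T = T ∧ ∀ g : G, T (Finsupp.single g 1) = Finsupp.single g 1 ∨
    ∀ g' ∈ (T (Finsupp.single g 1)).support, g' < g

def RLead {K G : Type*} [Field K] [LinearOrder G] (V : Submodule K (G →₀ K)) (g : G) : Prop :=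
  ∃ v ∈ V, v g ≠ 0 ∧ ∀ h ∈ v.support, h ≤ g

theorem rlead_disj {K G : Type*} [Field K] [LinearOrder G] (V : Submodule K (G →₀ K))
    (v : G →₀ K) (hv : v ∈ V) (hw : ∀ g, v g ≠ 0 → ¬ RLead V g) : v = 0 := by
  by_contra hne
  have hs : v.support.Nonempty := Finsupp.support_nonempty_iff.2 hne
  have hm := Finsupp.mem_support_iff.1 (v.support.max'_mem hs)
  exact hw _ hm ⟨v, hv, hm, fun h hh => v.support.le_max' h hh⟩

theorem redOp_coeff {K G : Type*} [Field K] [LinearOrder G] (T : Module.End K (G →₀ K))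
    (hT : IsRedOp T) (g : G) (y : G →₀ K) (hy : ∀ h ∈ y.support, h ≤ g) :
    (T y) g = y g * (T (Finsupp.single g 1)) g := by
  have key : ∀ h, h < g → (T (Finsupp.single h 1)) g = 0 := by
    intro h hg
    rcases hT.2 h with h1 | h1
    · rw [h1, Finsupp.single_eq_of_ne (ne_of_gt hg)]
    · by_contra hc
      exact lt_asymm hg (h1 g (Finsupp.mem_support_iff.2 hc))
  have e : T y = y.sum (fun h c => c • T (Finsupp.single h 1)) := by
    conv_lhs => rw [← Finsupp.sum_single y]
    rw [Finsupp.sum, map_sum, Finsupp.sum]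
    refine Finset.sum_congr rfl fun h _ => ?_
    rw [← map_smul, Finsupp.smul_single_one]
  rw [e, Finsupp.sum, Finsupp.finsetSum_apply, Finset.sum_eq_single g]
  · simp
  · intro h hh hne
    simp [key h (lt_of_le_of_ne (hy h hh) hne)]
  · intro hg
    simp [Finsupp.notMem_support_iff.1 hg]

theorem redOp_range {K G : Type*} [Field K] [LinearOrder G] (T : Module.End K (G →₀ K))
    (hT : IsRedOp T) (x : G →₀ K) (hx : T x = x) (g : G) (hg : x g ≠ 0) :
    ¬ RLead (LinearMap.ker T) g := by
  classical
  have hfix : ∀ g, ¬ RLead (LinearMap.ker T) g →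
      T (Finsupp.single g 1) = Finsupp.single g 1 := by
    intro g hn
    rcases hT.2 g with h1 | h1
    · exact h1
    · exfalso
      have h0 : (T (Finsupp.single g 1)) g = 0 := by
        by_contra hc
        exact lt_irrefl _ (h1 g (Finsupp.mem_support_iff.2 hc))
      refine hn ⟨Finsupp.single g 1 - T (Finsupp.single g 1), ?_, ?_, ?_⟩
      · have := LinearMap.congr_fun hT.1 (Finsupp.single g 1)
        simp only [LinearMap.comp_apply] at this
        rw [LinearMap.mem_ker, map_sub, this, sub_self]
      · simp [h0]
      · intro h hh
        by_contra hc
        have hne : h ≠ g := fun e => hc e.le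
        rw [Finsupp.mem_support_iff, Finsupp.sub_apply, Finsupp.single_eq_of_ne hne,
          zero_sub, neg_ne_zero] at hh
        exact hc (h1 h (Finsupp.mem_support_iff.2 hh)).le
  have hlead : ∀ g, RLead (LinearMap.ker T) g → (T (Finsupp.single g 1)) g = 0 := by
    rintro g ⟨v, hv, hvg, hs⟩
    have := redOp_coeff T hT g v hs
    rw [LinearMap.mem_ker.1 hv] at this
    simpa [hvg] using this.symm
  have hrest : ∀ z : G →₀ K, (∀ g ∈ z.support, ¬ RLead (LinearMap.ker T) g) → T z = z := by
    intro z hz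
    conv_lhs => rw [← Finsupp.sum_single z]
    conv_rhs => rw [← Finsupp.sum_single z]
    rw [Finsupp.sum, map_sum]
    refine Finset.sum_congr rfl fun h hh => ?_
    rw [← Finsupp.smul_single_one, map_smul, hfix h (hz h hh)]
  intro hl
  set y := x.filter (RLead (LinearMap.ker T)) with hy
  set z := x.filter (fun g => ¬ RLead (LinearMap.ker T) g) with hz
  have hyz : y + z = x := Finsupp.filter_add_filter_not x _
  have hTz : T z = z := hrest z (fun g hg => by
    rw [hz, Finsupp.support_filter, Finset.mem_filter] at hg
    exact hg.2)
  have hTy : T y = y := by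
    have h := hx
    rw [← hyz, map_add, hTz] at h
    exact add_right_cancel h
  have hyg : y g ≠ 0 := by rw [hy, Finsupp.filter_apply_pos _ _ hl]; exact hg
  have hs : y.support.Nonempty := ⟨g, Finsupp.mem_support_iff.2 hyg⟩
  have hm := y.support.max'_mem hs
  have hml : RLead (LinearMap.ker T) (y.support.max' hs) := by
    by_contra hc
    exact Finsupp.mem_support_iff.1 hm (Finsupp.filter_apply_neg _ x hc)
  have := redOp_coeff T hT (y.support.max' hs) y (fun h hh => y.support.le_max' h hh)
  rw [hlead _ hml, mul_zero, hTy] at this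
  exact Finsupp.mem_support_iff.1 hm this

theorem rlead_exists {K G : Type*} [Field K] [LinearOrder G] [WellFoundedLT G]
    (V : Submodule K (G →₀ K)) (g : G) :
    ∃ w : G →₀ K, Finsupp.single g 1 - w ∈ V ∧ (∀ h, w h ≠ 0 → ¬ RLead V h) ∧
      (w = Finsupp.single g 1 ∨ ∀ h ∈ w.support, h < g) := by
  induction g using WellFoundedLT.induction with
  | ind g ih =>
  by_cases hl : RLead V g
  · choose! f hf using ih
    obtain ⟨v, hv, hvg, hs⟩ := hl
    set u : G →₀ K := Finsupp.single g 1 - (v g)⁻¹ • v with hu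
    have hus : ∀ h ∈ u.support, h < g := by
      intro h hh
      rw [Finsupp.mem_support_iff] at hh
      by_cases e : h = g
      · subst e
        simp [hu, hvg] at hh
      · refine lt_of_le_of_ne (hs h ?_) e
        rw [Finsupp.mem_support_iff]
        intro h0
        simp [hu, h0, Finsupp.single_eq_of_ne e] at hh
    have hsum : ∀ h, (∑ a ∈ u.support, u a • f a) h ≠ 0 → ∃ a ∈ u.support, f a h ≠ 0 := by
      intro h hh
      rw [Finsupp.finsetSum_apply] at hh
      obtain ⟨a, ha, hne⟩ := Finset.exists_ne_zero_of_sum_ne_zero hh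
      refine ⟨a, ha, fun h0 => hne ?_⟩
      simp [h0]
    refine ⟨∑ a ∈ u.support, u a • f a, ?_, ?_, Or.inr ?_⟩
    · have e1 : Finsupp.single g 1 - ∑ a ∈ u.support, u a • f a =
          (v g)⁻¹ • v + ∑ a ∈ u.support, u a • (Finsupp.single a 1 - f a) := by
        have e2 : ∑ a ∈ u.support, u a • (Finsupp.single a (1 : K)) = u := by
          conv_rhs => rw [← Finsupp.sum_single u]
          exact Finset.sum_congr rfl fun a _ => Finsupp.smul_single_one _ _
        simp only [smul_sub, Finset.sum_sub_distrib, e2]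
        rw [hu]; abel
      rw [e1]
      exact V.add_mem (V.smul_mem _ hv)
        (V.sum_mem fun a ha => V.smul_mem _ (hf a (hus a ha)).1)
    · intro h hh
      obtain ⟨a, ha, hne⟩ := hsum h hh
      exact (hf a (hus a ha)).2.1 h hne
    · intro h hh
      obtain ⟨a, ha, hne⟩ := hsum h (Finsupp.mem_support_iff.1 hh)
      rcases (hf a (hus a ha)).2.2 with h1 | h1
      · rw [h1] at hne
        have : h = a := by
          by_contra e
          exact hne (Finsupp.single_eq_of_ne e)
        exact this ▸ hus a ha
      · exact (h1 h (Finsupp.mem_support_iff.2 hne)).trans (hus a ha)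
  · refine ⟨Finsupp.single g 1, by simp, ?_, Or.inl rfl⟩
    intro h hh
    have : h = g := by
      by_contra e
      exact hh (Finsupp.single_eq_of_ne e)
    exact this ▸ hl

/-- The kernel map is a bijection from reduction operators onto the subspaces
of `K⟨G⟩`. -/
theorem redOp_ker_bijective {K G : Type*} [Field K] [LinearOrder G]
    [WellFoundedLT G] :
    Function.Bijective
      (fun T : {T : Module.End K (G →₀ K) // IsRedOp T} =>
        LinearMap.ker (T : Module.End K (G →₀ K))) := by
  constructor
  · rintro ⟨T, hT⟩ ⟨S, hS⟩ h
    simp only at h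
    have iT : ∀ x, T (T x) = T x := fun x => LinearMap.congr_fun hT.1 x
    have iS : ∀ x, S (S x) = S x := fun x => LinearMap.congr_fun hS.1 x
    refine Subtype.ext (LinearMap.ext fun x => ?_)
    refine sub_eq_zero.1 (rlead_disj (LinearMap.ker T) (T x - S x) ?_ ?_)
    · have h1 : x - T x ∈ LinearMap.ker T := by simp [iT]
      have h2 : x - S x ∈ LinearMap.ker T := by rw [h]; simp [iS]
      have := Submodule.sub_mem _ h2 h1
      rwa [sub_sub_sub_cancel_left] at this
    · intro g hg
      by_cases h0 : T x g = 0
      · have h1 : S x g ≠ 0 := fun h1 => hg (by simp [h0, h1])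
        rw [h]
        exact redOp_range S hS (S x) (iS x) g h1
      · exact redOp_range T hT (T x) (iT x) g h0
  · intro V
    choose f hf using rlead_exists V
    set T : Module.End K (G →₀ K) := Finsupp.linearCombination K f with hTdef
    have hTs : ∀ g, T (Finsupp.single g 1) = f g := by intro g; simp [hTdef]
    have hV : ∀ x, x - T x ∈ V := by
      intro x
      induction x using Finsupp.induction_linear with
      | zero => simp
      | add a b ha hb =>
        rw [map_add, add_sub_add_comm]; exact V.add_mem ha hb
      | single g c =>
        rw [← Finsupp.smul_single_one, map_smul, hTs, ← smul_sub]
        exact V.smul_mem _ (hf g).1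
    have hW : ∀ x g, T x g ≠ 0 → ¬ RLead V g := by
      intro x g hg
      rw [hTdef, Finsupp.linearCombination_apply, Finsupp.sum, Finsupp.finsetSum_apply] at hg
      obtain ⟨a, ha, hne⟩ := Finset.exists_ne_zero_of_sum_ne_zero hg
      refine (hf a).2.1 g fun h0 => hne ?_
      simp [h0]
    have hz : ∀ x ∈ V, T x = 0 := by
      intro x hx
      refine rlead_disj V _ ?_ (hW x)
      have := V.sub_mem hx (hV x)
      rwa [sub_sub_cancel] at this
    refine ⟨⟨T, LinearMap.ext fun x => ?_, fun g => ?_⟩, ?_⟩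
    · have := hz _ (hV x)
      rw [map_sub, sub_eq_zero] at this
      exact this.symm
    · rw [hTs]; exact (hf g).2.2
    · ext x
      simp only [LinearMap.mem_ker]
      refine ⟨fun h => ?_, hz x⟩
      have := hV x
      rwa [h, sub_zero] at this
end

section
/- Let F be a set of reduction operators relative to a well-ordered set (G,<), let v ∈ K⟨G⟩, and let (R_n) be a sequence of elements of the monoid ⟨F⟩ generated by F under composition, such that for every n, R_n is a right divisor of R_{n+1} in ⟨F⟩ (i.e., R_{n+1} = R'_n ∘ R_n for some R'_n ∈ ⟨F⟩). Then the sequence (R_n(v)) is eventually constant. -/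
/-- Lexicographic descent: `x` agrees with `y` above some `j`, and vanishes at `j` where `y` does not. -/
def RedLt {K G : Type*} [Field K] [LinearOrder G] (x y : G →₀ K) : Prop :=
  Finsupp.Lex (fun a b : G => b < a) (fun a b : K => a = 0 ∧ b ≠ 0) x y

theorem redLt_wf {K G : Type*} [Field K] [LinearOrder G] [WellFoundedLT G] :
    WellFounded (RedLt (K := K) (G := G)) := by
  have hs : WellFounded (fun a b : K => a = 0 ∧ b ≠ 0) := by
    have h0 : Acc (fun a b : K => a = 0 ∧ b ≠ 0) 0 := ⟨_, fun y hy => absurd rfl hy.2⟩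
    exact ⟨fun a => ⟨_, fun y hy => hy.1 ▸ h0⟩⟩
  have : Std.Trichotomous (fun a b : G => b < a) :=
    ⟨fun a b h1 h2 => le_antisymm (not_lt.1 h1) (not_lt.1 h2)⟩
  exact Finsupp.Lex.wellFounded' (r := fun a b : G => b < a)
    (s := fun a b : K => a = 0 ∧ b ≠ 0) (fun n h => h.2 rfl) hs
    (wellFounded_lt (α := G))

theorem redOp_apply {K G : Type*} [Field K] [LinearOrder G]
    (T : Module.End K (G →₀ K)) (w : G →₀ K) (d : G) :
    T w d = ∑ h ∈ w.support, w h * T (Finsupp.single h 1) d := by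
  conv_lhs => rw [← Finsupp.sum_single w]
  simp only [Finsupp.sum, map_sum, Finsupp.finsetSum_apply]
  refine Finset.sum_congr rfl fun h _ => ?_
  have : Finsupp.single h (w h) = w h • Finsupp.single h (1 : K) := by simp
  rw [this, map_smul]; rfl

theorem redOp_step {K G : Type*} [Field K] [LinearOrder G]
    (T : Module.End K (G →₀ K)) (hT : IsRedOp T) (w : G →₀ K) :
    T w = w ∨ RedLt (T w) w := by
  classical
  by_cases hne : (w.support.filter fun h => T (Finsupp.single h 1) ≠ Finsupp.single h 1).Nonempty
  · right
    obtain ⟨g, hg, hmax⟩ := Finset.exists_max_image _ id hne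
    rw [Finset.mem_filter] at hg
    have fixed : ∀ h ∈ w.support, g < h → T (Finsupp.single h 1) = Finsupp.single h 1 := by
      intro h hh hgh
      by_contra hc
      exact absurd (hmax h (Finset.mem_filter.2 ⟨hh, hc⟩)) (not_le.2 hgh)
    have hzero : ∀ h d, h < d → T (Finsupp.single h 1) d = 0 := by
      intro h d hd
      rcases hT.2 h with h1 | h1
      · rw [h1, Finsupp.single_eq_of_ne]; exact hd.ne'
      · by_contra hc
        exact absurd (h1 d (Finsupp.mem_support_iff.2 hc)) (not_lt.2 hd.le)
    refine ⟨g, ?_, ?_, Finsupp.mem_support_iff.1 hg.1⟩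
    · intro d hd
      have hid := redOp_apply (LinearMap.id : Module.End K (G →₀ K)) w d
      rw [LinearMap.id_apply] at hid
      change T w d = w d
      rw [redOp_apply, hid]
      refine Finset.sum_congr rfl fun h hh => ?_
      rw [LinearMap.id_apply]
      rcases lt_or_ge g h with h1 | h1
      · rw [fixed h hh h1]
      · rw [hzero h d (lt_of_le_of_lt h1 hd), Finsupp.single_eq_of_ne]
        exact (lt_of_le_of_lt h1 hd).ne'
    · change T w g = 0
      rw [redOp_apply]
      refine Finset.sum_eq_zero fun h hh => ?_
      rcases lt_trichotomy g h with h1 | h1 | h1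
      · rw [fixed h hh h1, Finsupp.single_eq_of_ne h1.ne, mul_zero]
      · subst h1
        rcases hT.2 g with h2 | h2
        · exact absurd h2 hg.2
        · have : T (Finsupp.single g 1) g = 0 := by
            by_contra hc
            exact lt_irrefl _ (h2 g (Finsupp.mem_support_iff.2 hc))
          rw [this, mul_zero]
      · rw [hzero h g h1, mul_zero]
  · left
    ext d
    have hid := redOp_apply (LinearMap.id : Module.End K (G →₀ K)) w d
    rw [LinearMap.id_apply] at hid
    rw [redOp_apply, hid]
    refine Finset.sum_congr rfl fun h hh => ?_
    rw [LinearMap.id_apply]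
    have : T (Finsupp.single h 1) = Finsupp.single h 1 := by
      by_contra hc
      exact hne ⟨h, Finset.mem_filter.2 ⟨hh, hc⟩⟩
    rw [this]

theorem redOp_closure_step {K G : Type*} [Field K] [LinearOrder G]
    (F : Set (Module.End K (G →₀ K))) (hF : ∀ T ∈ F, IsRedOp T)
    (R : Module.End K (G →₀ K)) (hR : R ∈ Submonoid.closure F) :
    ∀ w, R w = w ∨ Relation.TransGen RedLt (R w) w := by
  induction hR using Submonoid.closure_induction with
  | mem T hT => exact fun w => (redOp_step T (hF T hT) w).imp_right .single
  | one => exact fun w => Or.inl rfl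
  | mul A B _ _ hA hB =>
    intro w
    rw [Module.End.mul_apply]
    rcases hB w with h | h
    · rw [h]; exact hA w
    · rcases hA (B w) with h2 | h2
      · rw [h2]; exact Or.inr h
      · exact Or.inr (h2.trans h)

/-- If each `R n` belongs to the monoid generated by a set `F` of reduction
operators and `R n` is a right divisor of `R (n+1)` in this monoid, then the
sequence `R n v` is eventually constant. -/
theorem redOp_sequence_stationary {K G : Type*} [Field K] [LinearOrder G]
    [WellFoundedLT G] (F : Set (Module.End K (G →₀ K)))
    (hF : ∀ T ∈ F, IsRedOp T) (v : G →₀ K)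
    (R : ℕ → Module.End K (G →₀ K))
    (hmem : ∀ n, R n ∈ Submonoid.closure F)
    (hdiv : ∀ n, ∃ R' ∈ Submonoid.closure F, R (n + 1) = R' * R n) :
    ∃ N, ∀ n ≥ N, R n v = R N v := by
  have wf : WellFounded (Relation.TransGen (RedLt (K := K) (G := G))) := redLt_wf.transGen
  obtain ⟨_, ⟨N, rfl⟩, hmin⟩ := wf.has_min (Set.range fun n => R n v) ⟨_, 0, rfl⟩
  refine ⟨N, fun n hn => ?_⟩
  induction n, hn using Nat.le_induction with
  | base => rfl
  | succ n _ ih =>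
    obtain ⟨R', hR', h⟩ := hdiv n
    have hs : R (n + 1) v = R' (R N v) := by rw [h, Module.End.mul_apply, ih]
    rcases redOp_closure_step F hF R' hR' (R N v) with h1 | h1
    · rw [hs, h1]
    · rw [← hs] at h1
      exact absurd h1 (hmin _ ⟨n + 1, rfl⟩)
end

section
/- A set F of reduction operators has the Church-Rosser property if and only if the associated abstract rewriting relation →_F has the Church-Rosser property; consequently, F is confluent if and only if →_F is a confluent abstract rewriting relation. -/
/-- The one-step rewriting relation associated with `F`. -/
def RedStep {K G : Type*} [Field K] [LinearOrder G]
    (F : Set (Module.End K (G →₀ K))) (v v' : G →₀ K) : Prop :=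
  ∃ T ∈ F, v ∉ Submodule.span K
      ((fun g => Finsupp.single g (1 : K)) ''
        {g : G | T (Finsupp.single g 1) = Finsupp.single g 1}) ∧
    v' = T v

section Helpers

variable {K G : Type*} [Field K] [LinearOrder G]

theorem aux_apply (T : Module.End K (G →₀ K)) (v : G →₀ K) (j : G) :
    (T v) j = ∑ h ∈ v.support, v h * (T (Finsupp.single h 1)) j := by
  conv_lhs => rw [← Finsupp.sum_single v]
  rw [Finsupp.sum, map_sum, Finsupp.finsetSum_apply]
  refine Finset.sum_congr rfl fun h _ => ?_
  have : Finsupp.single h (v h) = v h • Finsupp.single h (1 : K) := by simp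
  rw [this, map_smul]
  simp

theorem aux_span (P : G → Prop) (v : G →₀ K) (hv : ∀ g ∈ v.support, P g) :
    v ∈ Submodule.span K ((fun g => Finsupp.single g (1 : K)) '' {g : G | P g}) := by
  rw [← Finsupp.sum_single v]
  refine Submodule.sum_mem _ fun g hg => ?_
  have : Finsupp.single g (v g) = v g • Finsupp.single g (1 : K) := by simp
  rw [this]
  exact Submodule.smul_mem _ _ (Submodule.subset_span ⟨g, hv g hg, rfl⟩)

theorem aux_fix {T : Module.End K (G →₀ K)} {v : G →₀ K}
    (hv : v ∈ Submodule.span K ((fun g => Finsupp.single g (1 : K)) ''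
        {g : G | T (Finsupp.single g 1) = Finsupp.single g 1})) : T v = v := by
  induction hv using Submodule.span_induction with
  | mem x hx => obtain ⟨g, hg, rfl⟩ := hx; exact hg
  | zero => simp
  | add x y _ _ hx hy => rw [map_add, hx, hy]
  | smul a x _ hx => rw [map_smul, hx]

theorem aux_zero {T : Module.End K (G →₀ K)} (hT : IsRedOp T) {h j : G}
    (hn : T (Finsupp.single h 1) ≠ Finsupp.single h 1) (hj : h ≤ j) :
    (T (Finsupp.single h 1)) j = 0 := by
  by_contra hc
  rcases hT.2 h with h1 | h1
  · exact hn h1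
  · exact absurd (h1 j (Finsupp.mem_support_iff.2 hc)) (not_lt.2 hj)

theorem aux_key {T : Module.End K (G →₀ K)} (hT : IsRedOp T) (v : G →₀ K) :
    (∀ g ∈ v.support, T (Finsupp.single g 1) = Finsupp.single g 1) ∨
    ∃ g, v g ≠ 0 ∧ (T v) g = 0 ∧ ∀ j, g < j → (T v) j = v j := by
  classical
  by_cases hS : (v.support.filter
      (fun g => T (Finsupp.single g 1) ≠ Finsupp.single g 1)).Nonempty
  · right
    obtain ⟨g, hg, hmax⟩ := Finset.exists_max_image _ id hS
    rw [Finset.mem_filter] at hg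
    have hle : ∀ h ∈ v.support, T (Finsupp.single h 1) ≠ Finsupp.single h 1 → h ≤ g :=
      fun h h1 h2 => hmax h (Finset.mem_filter.2 ⟨h1, h2⟩)
    refine ⟨g, Finsupp.mem_support_iff.1 hg.1, ?_, fun j hj => ?_⟩
    · rw [aux_apply]
      refine Finset.sum_eq_zero fun h hh => ?_
      by_cases hr : T (Finsupp.single h 1) = Finsupp.single h 1
      · have : h ≠ g := by rintro rfl; exact hg.2 hr
        rw [hr, Finsupp.single_eq_of_ne' this, mul_zero]
      · rw [aux_zero hT hr (hle h hh hr), mul_zero]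
    · rw [aux_apply]
      have h2 := aux_apply (LinearMap.id : Module.End K (G →₀ K)) v j
      simp only [LinearMap.id_apply] at h2
      rw [h2]
      refine Finset.sum_congr rfl fun h hh => ?_
      by_cases hr : T (Finsupp.single h 1) = Finsupp.single h 1
      · rw [hr]
      · have hlt := (hle h hh hr).trans_lt hj
        rw [aux_zero hT hr hlt.le, Finsupp.single_eq_of_ne' hlt.ne]
  · left
    intro g hg
    by_contra hc
    exact hS ⟨g, Finset.mem_filter.2 ⟨hg, hc⟩⟩

theorem aux_supp {T : Module.End K (G →₀ K)} (hT : IsRedOp T) {v : G →₀ K} (hv : T v = v) :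
    ∀ g ∈ v.support, T (Finsupp.single g 1) = Finsupp.single g 1 := by
  rcases aux_key hT v with h | ⟨g, h1, h2, _⟩
  · exact h
  · rw [hv] at h2; exact absurd h2 h1

theorem aux_red {T W : Module.End K (G →₀ K)} (hT : IsRedOp T) (hW : IsRedOp W)
    (hk : LinearMap.ker T ≤ LinearMap.ker W) {g : G}
    (hg : W (Finsupp.single g 1) = Finsupp.single g 1) :
    T (Finsupp.single g 1) = Finsupp.single g 1 := by
  by_contra hc
  have hlt := (hT.2 g).resolve_left hc
  have h1 : Finsupp.single g 1 - T (Finsupp.single g 1) ∈ LinearMap.ker W := by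
    apply hk
    rw [LinearMap.mem_ker, map_sub, sub_eq_zero]
    exact (LinearMap.congr_fun hT.1 (Finsupp.single g 1)).symm
  rw [LinearMap.mem_ker, map_sub, sub_eq_zero, hg] at h1
  have h2 := DFunLike.congr_fun h1 g
  rw [aux_apply, Finsupp.single_eq_same, Finset.sum_eq_zero] at h2
  · exact one_ne_zero h2
  · intro h hh
    have hl := hlt h hh
    by_cases hr : W (Finsupp.single h 1) = Finsupp.single h 1
    · rw [hr, Finsupp.single_eq_of_ne' hl.ne, mul_zero]
    · rw [aux_zero hW hr hl.le, mul_zero]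

theorem aux_step {F : Set (Module.End K (G →₀ K))} {T : Module.End K (G →₀ K)} (hT : T ∈ F)
    (v : G →₀ K) : Relation.ReflTransGen (RedStep F) v (T v) := by
  by_cases h : v ∈ Submodule.span K ((fun g => Finsupp.single g (1 : K)) ''
        {g : G | T (Finsupp.single g 1) = Finsupp.single g 1})
  · rw [aux_fix h]
  · exact .single ⟨T, hT, h, rfl⟩

theorem aux_reach {F : Set (Module.End K (G →₀ K))} (a b : G →₀ K) :
    Relation.ReflTransGen (RedStep F) a b ↔ ∃ R ∈ Submonoid.closure F, R a = b := by
  constructor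
  · intro h
    induction h with
    | refl => exact ⟨1, one_mem _, rfl⟩
    | tail _ h ih =>
      obtain ⟨R, hR, rfl⟩ := ih
      obtain ⟨T, hT, _, rfl⟩ := h
      exact ⟨T * R, mul_mem (Submonoid.subset_closure hT) hR, rfl⟩
  · rintro ⟨R, hR, rfl⟩
    induction hR using Submonoid.closure_induction generalizing a with
    | mem T hT => exact aux_step hT a
    | one => exact .refl
    | mul x y _ _ hx hy => exact (hy a).trans (hx (y a))

theorem aux_eqv {α : Type*} {r : α → α → Prop} {a b : α} (h : Relation.ReflTransGen r a b) :
    Relation.EqvGen r a b := by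
  induction h with
  | refl => exact .refl _
  | tail _ h ih => exact .trans _ _ _ ih (.rel _ _ h)

theorem aux_ker_eqv {F : Set (Module.End K (G →₀ K))} {x : G →₀ K}
    (hx : x ∈ ⨆ T ∈ F, LinearMap.ker T) :
    ∀ v, Relation.EqvGen (RedStep F) v (v + x) := by
  let S : AddSubmonoid (G →₀ K) :=
    { carrier := {x | ∀ v, Relation.EqvGen (RedStep F) v (v + x)}
      zero_mem' := fun v => by simpa using Relation.EqvGen.refl v
      add_mem' := fun {a b} ha hb v => by
        rw [← add_assoc]
        exact .trans _ _ _ (ha v) (hb (v + a)) }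
  change x ∈ S
  rw [iSup_subtype'] at hx
  refine Submodule.iSup_induction (fun T : F => LinearMap.ker T.1) (motive := (· ∈ S)) hx
    ?_ S.zero_mem (fun a b => S.add_mem)
  intro T a ha v
  have h : T.1 (v + a) = T.1 v := by rw [map_add, LinearMap.mem_ker.1 ha, add_zero]
  have h2 := aux_eqv (aux_step T.2 (v + a))
  rw [h] at h2
  exact .trans _ _ _ (aux_eqv (aux_step T.2 v)) (.symm _ _ h2)

theorem aux_wf [WellFoundedLT G] {F : Set (Module.End K (G →₀ K))} (hF : ∀ T ∈ F, IsRedOp T) :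
    WellFounded (fun a b => RedStep F b a) := by
  have hs : WellFounded (fun a b : K => a = 0 ∧ b ≠ 0) := by
    have h0 : Acc (fun a b : K => a = 0 ∧ b ≠ 0) 0 := ⟨_, fun y hy => absurd rfl hy.2⟩
    exact ⟨fun a => ⟨_, fun y hy => hy.1 ▸ h0⟩⟩
  have hw := Finsupp.Lex.wellFounded' (α := G) (N := K)
    (s := fun a b : K => a = 0 ∧ b ≠ 0) (fun n h => h.2 rfl) hs (r := (· > ·))
    (wellFounded_lt (α := G))
  refine Subrelation.wf ?_ hw
  rintro a b ⟨T, hT, hb, rfl⟩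
  rcases aux_key (hF T hT) b with h | ⟨g, h1, h2, h3⟩
  · exact absurd (aux_span _ _ h) hb
  · exact ⟨g, h3, h2, h1⟩

theorem aux_conf {α : Type*} {r : α → α → Prop}
    (hc : ∀ a b c, Relation.ReflTransGen r a b → Relation.ReflTransGen r a c →
      ∃ d, Relation.ReflTransGen r b d ∧ Relation.ReflTransGen r c d)
    (u v : α) (h : Relation.EqvGen r u v) :
    ∃ w, Relation.ReflTransGen r u w ∧ Relation.ReflTransGen r v w := by
  induction h with
  | rel x y h => exact ⟨y, .single h, .refl⟩
  | refl x => exact ⟨x, .refl, .refl⟩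
  | symm x y _ ih => obtain ⟨w, h1, h2⟩ := ih; exact ⟨w, h2, h1⟩
  | trans x y z _ _ ih1 ih2 =>
    obtain ⟨w, h1, h2⟩ := ih1
    obtain ⟨w', h3, h4⟩ := ih2
    obtain ⟨d, h5, h6⟩ := hc _ _ _ h2 h3
    exact ⟨d, h1.trans h5, h4.trans h6⟩

end Helpers

/-- `F` has the Church-Rosser property iff `→_F` has the Church-Rosser
property; consequently `F` is confluent iff `→_F` is confluent.
Here `W` denotes `∧F`. -/
theorem churchRosser_iff_and_confluent_iff {K G : Type*} [Field K]
    [LinearOrder G] [WellFoundedLT G] (F : Set (Module.End K (G →₀ K)))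
    (hF : ∀ T ∈ F, IsRedOp T) (W : Module.End K (G →₀ K)) (hW : IsRedOp W)
    (hker : LinearMap.ker W = ⨆ T ∈ F, LinearMap.ker T) :
    ((∀ v : G →₀ K, ∃ R ∈ Submonoid.closure F, R v = W v) ↔
      (∀ u v : G →₀ K, Relation.EqvGen (RedStep F) u v →
        ∃ w : G →₀ K, Relation.ReflTransGen (RedStep F) u w ∧
          Relation.ReflTransGen (RedStep F) v w)) ∧
    (({g : G | ∀ T ∈ F, T (Finsupp.single g 1) = Finsupp.single g 1} ⊆
        {g : G | W (Finsupp.single g 1) = Finsupp.single g 1}) ↔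
      (∀ a b c : G →₀ K, Relation.ReflTransGen (RedStep F) a b →
        Relation.ReflTransGen (RedStep F) a c →
          ∃ d : G →₀ K, Relation.ReflTransGen (RedStep F) b d ∧
            Relation.ReflTransGen (RedStep F) c d)) := by
  have hkT : ∀ T ∈ F, LinearMap.ker T ≤ LinearMap.ker W := fun T hT => by
    rw [hker]; exact le_iSup₂_of_le T hT le_rfl
  have hWeq : ∀ u v, Relation.EqvGen (RedStep F) u v → W u = W v := by
    intro u v h
    induction h with
    | rel x y h =>
      obtain ⟨T, hT, _, rfl⟩ := h
      rw [← sub_eq_zero, ← map_sub, ← LinearMap.mem_ker]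
      apply hkT T hT
      rw [LinearMap.mem_ker, map_sub, sub_eq_zero]
      exact (LinearMap.congr_fun (hF T hT).1 x).symm
    | refl x => rfl
    | symm x y _ ih => exact ih.symm
    | trans x y z _ _ h1 h2 => exact h1.trans h2
  have hWW : ∀ v, W (W v) = W v := fun v => LinearMap.congr_fun hW.1 v
  have hWv : ∀ v, Relation.EqvGen (RedStep F) v (W v) := by
    intro v
    have h : W v - v ∈ ⨆ T ∈ F, LinearMap.ker T := by
      rw [← hker, LinearMap.mem_ker, map_sub, hWW, sub_self]
    simpa using aux_ker_eqv h v
  have hnorm : ∀ v w, Relation.ReflTransGen (RedStep F) (W v) w → w = W v := by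
    intro v w h
    rcases Relation.ReflTransGen.cases_head h with h | ⟨c, ⟨T, hT, h1, _⟩, _⟩
    · exact h.symm
    · exact absurd (aux_span _ _ fun g hg =>
        aux_red (hF T hT) hW (hkT T hT) (aux_supp hW (hWW v) g hg)) h1
  have hA : (∀ v : G →₀ K, ∃ R ∈ Submonoid.closure F, R v = W v) ↔
      (∀ u v : G →₀ K, Relation.EqvGen (RedStep F) u v →
        ∃ w : G →₀ K, Relation.ReflTransGen (RedStep F) u w ∧
          Relation.ReflTransGen (RedStep F) v w) := by
    simp only [← aux_reach]
    constructor
    · intro h u v huv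
      exact ⟨W u, h u, hWeq u v huv ▸ h v⟩
    · intro h v
      obtain ⟨w, h1, h2⟩ := h _ _ (hWv v)
      rwa [hnorm v w h2] at h1
  refine ⟨hA, ?_, ?_⟩
  · intro h
    have hr : ∀ v : G →₀ K, ∃ R ∈ Submonoid.closure F, R v = W v := by
      simp only [← aux_reach]
      intro v
      induction v using (aux_wf hF).induction with
      | _ v ih =>
      by_cases hv : ∃ v', RedStep F v v'
      · obtain ⟨v', hv'⟩ := hv
        rw [hWeq v v' (.rel _ _ hv')]
        exact .head hv' (ih v' hv')
      · have : W v = v := by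
          apply aux_fix
          apply aux_span
          intro g hg
          refine h fun T hT => ?_
          refine aux_supp (hF T hT) ?_ g hg
          by_contra hc
          exact hv ⟨T v, T, hT, fun hm => hc (aux_fix hm), rfl⟩
        rw [this]
    intro a b c hab hac
    exact hA.1 hr b c (.trans _ _ _ (.symm _ _ (aux_eqv hab)) (aux_eqv hac))
  · intro h g hg
    obtain ⟨R, hR, hRW⟩ := hA.2 (aux_conf h) (Finsupp.single g 1)
    have : R (Finsupp.single g 1) = Finsupp.single g 1 := by
      clear hRW
      induction hR using Submonoid.closure_induction with
      | mem T hT => exact hg T hT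
      | one => rfl
      | mul x y _ _ hx hy => rw [Module.End.mul_apply, hy, hx]
    exact hRW.symm.trans this
end
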